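/- arXiv:2312.05590 — 3 statements merged into one kernel-verified Lean document; each statement's English description precedes it below -/
import Mathlib

section
/- Let d ≥ 1, 2 ≤ p < ∞, 1 < q ≤ 2 with 1/p + 1/q = 1, and h(w) = ‖w‖_q²/(2(q−1)) on ℝ^d. Let ζ_0, …, ζ_{r−1} ∈ ℝ^d be vectors and a_0, …, a_{r−1} positive reals, and define v_i := argmin_{v ∈ ℝ^d} { ∑_{j=0}^{i−1} a_j⟨ζ_j, v⟩ + h(v) } for i = 0, 1, …, r (so v_0 = 0). Then for every w* ∈ ℝ^d, ∑_{i=0}^{r−1} a_i⟨ζ_i, v_{i+1} − w*⟩ ≤ h(w*) − (1/2)∑_{i=0}^{r−1} ‖v_i − v_{i+1}‖_q². -/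
noncomputable section

open Real

/-- The ℓ_p norm of a vector in ℝ^d, for a real exponent `p`. -/
def lpNorm {d : ℕ} (p : ℝ) (x : Fin d → ℝ) : ℝ :=
  (∑ i, |x i| ^ p) ^ (1 / p)

/-- First-derivative estimate. -/
lemma aux_deriv (s : ℝ) (hs0 : 0 < s) (hs1 : s ≤ 1) (t : ℝ) (ht0 : 0 ≤ t) (ht1 : t ≤ 1) :
    2 * s * t ≤ (1 + t) ^ s - (1 - t) ^ s := by
  have hmono : MonotoneOn (fun t : ℝ => (1 + t) ^ s - (1 - t) ^ s - 2 * s * t) (Set.Icc 0 1) := by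
    apply monotoneOn_of_hasDerivWithinAt_nonneg (convex_Icc 0 1)
      (f' := fun t => s * (1 + t) ^ (s - 1) + s * (1 - t) ^ (s - 1) - 2 * s)
    · apply ContinuousOn.sub
      · apply ContinuousOn.sub
        · exact ContinuousOn.rpow_const (by fun_prop) (fun x _ => Or.inr hs0.le)
        · exact ContinuousOn.rpow_const (by fun_prop) (fun x _ => Or.inr hs0.le)
      · fun_prop
    · intro x hx
      rw [interior_Icc] at hx
      apply HasDerivAt.hasDerivWithinAt
      have h1 : HasDerivAt (fun t : ℝ => (1 + t) ^ s) (1 * s * (1 + x) ^ (s - 1)) x :=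
        ((hasDerivAt_id x).const_add 1).rpow_const (Or.inl (by simp only [id]; linarith [hx.1]))
      have h2 : HasDerivAt (fun t : ℝ => (1 - t) ^ s) (-1 * s * (1 - x) ^ (s - 1)) x :=
        ((hasDerivAt_id x).const_sub 1).rpow_const (Or.inl (by simp only [id]; linarith [hx.2]))
      have h3 : HasDerivAt (fun t : ℝ => 2 * s * t) (2 * s * 1) x :=
        (hasDerivAt_id x).const_mul (2 * s)
      refine ((h1.sub h2).sub h3).congr_deriv ?_
      ring
    · intro x hx
      rw [interior_Icc] at hx
      obtain ⟨hx0, hx1⟩ := hx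
      have hA : 0 < (1 + x) ^ (s - 1) := rpow_pos_of_pos (by linarith) _
      have hB : 0 < (1 - x) ^ (s - 1) := rpow_pos_of_pos (by linarith) _
      have hAB : 1 ≤ (1 + x) ^ (s - 1) * (1 - x) ^ (s - 1) := by
        rw [← mul_rpow (by linarith) (by linarith)]
        apply one_le_rpow_of_pos_of_le_one_of_nonpos <;> nlinarith
      have : 2 ≤ (1 + x) ^ (s - 1) + (1 - x) ^ (s - 1) := by
        nlinarith [sq_nonneg ((1 + x) ^ (s - 1) - (1 - x) ^ (s - 1))]
      nlinarith
  have := hmono (Set.left_mem_Icc.2 zero_le_one) ⟨ht0, ht1⟩ ht0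
  simp at this
  linarith

lemma aux_two (q : ℝ) (hq1 : 1 < q) (hq2 : q ≤ 2) (t : ℝ) (ht0 : 0 ≤ t) (ht1 : t ≤ 1) :
    2 + q * (q - 1) * t ^ 2 ≤ (1 + t) ^ q + (1 - t) ^ q := by
  have hmono : MonotoneOn (fun t : ℝ => (1 + t) ^ q + (1 - t) ^ q - q * (q - 1) * t ^ 2)
      (Set.Icc 0 1) := by
    apply monotoneOn_of_hasDerivWithinAt_nonneg (convex_Icc 0 1)
      (f' := fun t => q * (1 + t) ^ (q - 1) - q * (1 - t) ^ (q - 1) - q * (q - 1) * (2 * t))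
    · apply ContinuousOn.sub
      · apply ContinuousOn.add
        · exact ContinuousOn.rpow_const (by fun_prop) (fun x _ => Or.inr (by linarith))
        · exact ContinuousOn.rpow_const (by fun_prop) (fun x _ => Or.inr (by linarith))
      · fun_prop
    · intro x hx
      rw [interior_Icc] at hx
      apply HasDerivAt.hasDerivWithinAt
      have h1 : HasDerivAt (fun t : ℝ => (1 + t) ^ q) (1 * q * (1 + x) ^ (q - 1)) x :=
        ((hasDerivAt_id x).const_add 1).rpow_const (Or.inl (by simp only [id]; linarith [hx.1]))
      have h2 : HasDerivAt (fun t : ℝ => (1 - t) ^ q) (-1 * q * (1 - x) ^ (q - 1)) x :=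
        ((hasDerivAt_id x).const_sub 1).rpow_const (Or.inl (by simp only [id]; linarith [hx.2]))
      have h3 : HasDerivAt (fun t : ℝ => q * (q - 1) * t ^ 2) (q * (q - 1) * (2 * x)) x := by
        have := (hasDerivAt_pow 2 x).const_mul (q * (q - 1))
        simpa using this
      refine ((h1.add h2).sub h3).congr_deriv ?_
      ring
    · intro x hx
      rw [interior_Icc] at hx
      have := aux_deriv (q - 1) (by linarith) (by linarith) x hx.1.le hx.2.le
      nlinarith
  have := hmono (Set.left_mem_Icc.2 zero_le_one) ⟨ht0, ht1⟩ ht0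
  simp at this
  linarith

/-- scalar two-point inequality, nonneg ordered case -/
lemma aux_ord (q : ℝ) (hq1 : 1 < q) (hq2 : q ≤ 2) (a b : ℝ) (hb : 0 ≤ b) (hab : b ≤ a) :
    (a ^ 2 + (q - 1) * b ^ 2) ^ (q / 2) ≤ (|a + b| ^ q + |a - b| ^ q) / 2 := by
  rcases (hb.trans hab).eq_or_lt with h0 | ha
  · have hb0 : b = 0 := by linarith
    subst h0; subst hb0
    simp [zero_rpow (show q ≠ 0 by linarith), zero_rpow (show q / 2 ≠ 0 by linarith)]
  have ht0 : 0 ≤ b / a := by positivity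
  have ht1 : b / a ≤ 1 := (div_le_one ha).2 hab
  have h2 := aux_two q hq1 hq2 (b / a) ht0 ht1
  have h3 : (1 + (q - 1) * (b / a) ^ 2) ^ (q / 2) ≤ 1 + q / 2 * ((q - 1) * (b / a) ^ 2) :=
    rpow_one_add_le_one_add_mul_self (by nlinarith [sq_nonneg (b / a)]) (by linarith) (by linarith)
  have e1 : a ^ 2 + (q - 1) * b ^ 2 = a ^ 2 * (1 + (q - 1) * (b / a) ^ 2) := by
    field_simp
  have e2 : |a + b| = a * (1 + b / a) := by
    rw [abs_of_nonneg (by linarith)]; field_simp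
  have e3 : |a - b| = a * (1 - b / a) := by
    rw [abs_of_nonneg (by linarith)]; field_simp
  have e4 : (a ^ 2) ^ (q / 2) = a ^ q := by
    rw [← rpow_natCast a 2, ← rpow_mul ha.le]; congr 1; push_cast; ring
  rw [e1, e2, e3, mul_rpow (by positivity) (by nlinarith [sq_nonneg (b / a)]), e4,
    mul_rpow ha.le (by linarith), mul_rpow ha.le (by linarith)]
  have : 0 < a ^ q := rpow_pos_of_pos ha _
  nlinarith

lemma aux_nonneg (q : ℝ) (hq1 : 1 < q) (hq2 : q ≤ 2) (a b : ℝ) (ha : 0 ≤ a) (hb : 0 ≤ b) :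
    (a ^ 2 + (q - 1) * b ^ 2) ^ (q / 2) ≤ (|a + b| ^ q + |a - b| ^ q) / 2 := by
  rcases le_total b a with hab | hab
  · exact aux_ord q hq1 hq2 a b hb hab
  · have := aux_ord q hq1 hq2 b a ha hab
    rw [add_comm b a, abs_sub_comm b a] at this
    refine le_trans (rpow_le_rpow ?_ ?_ (by linarith)) this
    · nlinarith [sq_nonneg a, sq_nonneg b]
    · nlinarith [mul_nonneg (show 0 ≤ 2 - q by linarith) (show 0 ≤ b ^ 2 - a ^ 2 by nlinarith)]

lemma aux_scalar (q : ℝ) (hq1 : 1 < q) (hq2 : q ≤ 2) (a b : ℝ) :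
    (a ^ 2 + (q - 1) * b ^ 2) ^ (q / 2) ≤ (|a + b| ^ q + |a - b| ^ q) / 2 := by
  have h := aux_nonneg q hq1 hq2 |a| |b| (abs_nonneg a) (abs_nonneg b)
  rw [sq_abs, sq_abs] at h
  refine h.trans (le_of_eq ?_)
  rcases abs_cases a with ⟨e, _⟩ | ⟨e, _⟩ <;> rcases abs_cases b with ⟨e', _⟩ | ⟨e', _⟩ <;> rw [e, e']
  · rw [show a + -b = a - b by ring, show a - -b = a + b by ring]; ring
  · rw [show -a + b = -(a - b) by ring, show -a - b = -(a + b) by ring, abs_neg, abs_neg]; ring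
  · rw [show -a + -b = -(a + b) by ring, show -a - -b = -(a - b) by ring, abs_neg, abs_neg]

/-- reverse Minkowski -/
lemma aux_mink {ι : Type*} (s : Finset ι) (e : ℝ) (he : 1 ≤ e) (f g : ι → ℝ)
    (hf : ∀ i, 0 ≤ f i) (hg : ∀ i, 0 ≤ g i) :
    ((∑ i ∈ s, f i) ^ e + (∑ i ∈ s, g i) ^ e) ^ (1 / e)
      ≤ ∑ i ∈ s, (f i ^ e + g i ^ e) ^ (1 / e) := by
  classical
  induction s using Finset.induction_on with
  | empty =>
    simp [zero_rpow (show e ≠ 0 by linarith), zero_rpow (show e⁻¹ ≠ 0 from inv_ne_zero (by linarith))]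
  | insert i s hi ih =>
    rw [Finset.sum_insert hi, Finset.sum_insert hi, Finset.sum_insert hi]
    have := Real.Lp_add_le_of_nonneg (Finset.univ : Finset (Fin 2)) (f := ![f i, g i])
      (g := ![∑ i ∈ s, f i, ∑ i ∈ s, g i]) he
      (by intro j _; fin_cases j <;> simp [hf, hg])
      (by intro j _; fin_cases j <;> simp [Finset.sum_nonneg, hf, hg])
    simp only [Fin.sum_univ_two, Matrix.cons_val_zero, Matrix.cons_val_one] at this
    linarith

lemma lpNorm_sq {d : ℕ} (q : ℝ) (x : Fin d → ℝ) :
    lpNorm q x ^ 2 = (∑ i, |x i| ^ q) ^ (2 / q) := by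
  unfold lpNorm
  rw [← rpow_natCast, ← rpow_mul (Finset.sum_nonneg fun i _ => rpow_nonneg (abs_nonneg _) _)]
  congr 1; push_cast; ring

/-- 2-uniform convexity of the q-norm (Ball-Carlen-Lieb). -/
lemma aux_bcl {d : ℕ} (q : ℝ) (hq1 : 1 < q) (hq2 : q ≤ 2) (x y : Fin d → ℝ) :
    lpNorm q x ^ 2 + (q - 1) * lpNorm q y ^ 2
      ≤ (lpNorm q (x + y) ^ 2 + lpNorm q (x - y) ^ 2) / 2 := by
  have hq0 : 0 < q := by linarith
  have he : 1 ≤ 2 / q := by rw [le_div_iff₀ hq0]; linarith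
  have hS : ∀ z : Fin d → ℝ, 0 ≤ ∑ i, |z i| ^ q :=
    fun z => Finset.sum_nonneg fun i _ => rpow_nonneg (abs_nonneg _) _
  simp only [lpNorm_sq]
  have hpow : ∀ z : ℝ, (|z| ^ q) ^ (2 / q) = z ^ 2 := by
    intro z
    rw [← rpow_mul (abs_nonneg _), mul_div_cancel₀ _ hq0.ne', ← sq_abs z]
    exact rpow_natCast _ 2
  set c := (q - 1) ^ (q / 2) with hc
  have hc0 : 0 ≤ c := rpow_nonneg (by linarith) _
  have hce : c ^ (2 / q) = q - 1 := by
    rw [hc, ← rpow_mul (by linarith), show q / 2 * (2 / q) = 1 by field_simp, rpow_one]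
  have hm := aux_mink Finset.univ (2 / q) he (fun i => |x i| ^ q) (fun i => c * |y i| ^ q)
    (fun i => rpow_nonneg (abs_nonneg _) _)
    (fun i => mul_nonneg hc0 (rpow_nonneg (abs_nonneg _) _))
  rw [← Finset.mul_sum, mul_rpow hc0 (hS y), hce] at hm
  have hstep : ∀ i, ((|x i| ^ q) ^ (2 / q) + (c * |y i| ^ q) ^ (2 / q)) ^ (1 / (2 / q))
      ≤ (|x i + y i| ^ q + |x i - y i| ^ q) / 2 := by
    intro i
    rw [mul_rpow hc0 (rpow_nonneg (abs_nonneg _) _), hce, hpow, hpow, one_div_div]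
    exact aux_scalar q hq1 hq2 _ _
  have hm2 := hm.trans (Finset.sum_le_sum fun i _ => hstep i)
  rw [← Finset.sum_div, Finset.sum_add_distrib] at hm2
  have hL : 0 ≤ (∑ i, |x i| ^ q) ^ (2 / q) + (q - 1) * (∑ i, |y i| ^ q) ^ (2 / q) :=
    add_nonneg (rpow_nonneg (hS x) _) (mul_nonneg (by linarith) (rpow_nonneg (hS y) _))
  have hm3 := rpow_le_rpow (rpow_nonneg hL _) hm2 (show 0 ≤ 2 / q by linarith)
  rw [← rpow_mul hL, one_div_mul_cancel (by linarith), rpow_one] at hm3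
  refine hm3.trans ?_
  have hconv := (convexOn_rpow he).2 (Set.mem_Ici.2 (hS (x + y))) (Set.mem_Ici.2 (hS (x - y)))
    (show (0 : ℝ) ≤ 1 / 2 by norm_num) (show (0 : ℝ) ≤ 1 / 2 by norm_num) (by norm_num)
  simp only [smul_eq_mul, Pi.add_apply, Pi.sub_apply] at hconv ⊢
  convert hconv using 1
  · congr 1; ring
  · ring

lemma lpNorm_smul {d : ℕ} (q : ℝ) (hq : 0 < q) (c : ℝ) (hc : 0 ≤ c) (x : Fin d → ℝ) :
    lpNorm q (c • x) = c * lpNorm q x := by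
  unfold lpNorm
  simp only [Pi.smul_apply, smul_eq_mul, abs_mul, mul_rpow (abs_nonneg _) (abs_nonneg _)]
  rw [← Finset.mul_sum, mul_rpow (rpow_nonneg (abs_nonneg _) _)
    (Finset.sum_nonneg fun i _ => rpow_nonneg (abs_nonneg _) _), ← rpow_mul (abs_nonneg _),
    mul_one_div_cancel hq.ne', rpow_one, abs_of_nonneg hc]

/-- quadratic growth at a minimizer -/
lemma aux_growth {d : ℕ} (q : ℝ) (hq1 : 1 < q) (hq2 : q ≤ 2)
    (L : (Fin d → ℝ) → ℝ) (hL : ∀ x y, L ((1 / 2 : ℝ) • (x + y)) = (L x + L y) / 2)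
    (v : Fin d → ℝ)
    (hv : ∀ u, L v + lpNorm q v ^ 2 / (2 * (q - 1)) ≤ L u + lpNorm q u ^ 2 / (2 * (q - 1)))
    (u : Fin d → ℝ) :
    L v + lpNorm q v ^ 2 / (2 * (q - 1)) + 1 / 2 * lpNorm q (v - u) ^ 2
      ≤ L u + lpNorm q u ^ 2 / (2 * (q - 1)) := by
  have key : ∀ k : ℕ, ∀ u, L v + lpNorm q v ^ 2 / (2 * (q - 1))
      + 1 / 2 * (1 - (1 / 2) ^ k) * lpNorm q (v - u) ^ 2
      ≤ L u + lpNorm q u ^ 2 / (2 * (q - 1)) := by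
    intro k
    induction k with
    | zero => intro u; simpa using hv u
    | succ k ih =>
      intro u
      have h1 := ih ((1 / 2 : ℝ) • (v + u))
      have h2 := aux_bcl q hq1 hq2 ((1 / 2 : ℝ) • (v + u)) ((1 / 2 : ℝ) • (v - u))
      have e1 : (1 / 2 : ℝ) • (v + u) + (1 / 2 : ℝ) • (v - u) = v := by
        ext i; simp; ring
      have e2 : (1 / 2 : ℝ) • (v + u) - (1 / 2 : ℝ) • (v - u) = u := by
        ext i; simp; ring
      have e3 : v - (1 / 2 : ℝ) • (v + u) = (1 / 2 : ℝ) • (v - u) := by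
        ext i; simp; ring
      rw [e1, e2, lpNorm_smul q (by linarith) _ (by norm_num) (v - u)] at h2
      rw [e3, hL, lpNorm_smul q (by linarith) _ (by norm_num) (v - u)] at h1
      have h3 : lpNorm q ((1 / 2 : ℝ) • (v + u)) ^ 2 / (2 * (q - 1))
          ≤ (lpNorm q v ^ 2 / (2 * (q - 1)) + lpNorm q u ^ 2 / (2 * (q - 1))) / 2
            - 1 / 8 * lpNorm q (v - u) ^ 2 := by
        have hq : 0 < q - 1 := by linarith
        rw [div_le_iff₀ (by positivity)]
        field_simp
        linarith
      rw [pow_succ (1 / 2 : ℝ) k]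
      linarith
  have hlim : Filter.Tendsto (fun k : ℕ => L v + lpNorm q v ^ 2 / (2 * (q - 1))
      + 1 / 2 * (1 - (1 / 2 : ℝ) ^ k) * lpNorm q (v - u) ^ 2) Filter.atTop
      (nhds (L v + lpNorm q v ^ 2 / (2 * (q - 1))
      + 1 / 2 * (1 - 0) * lpNorm q (v - u) ^ 2)) := by
    have := tendsto_pow_atTop_nhds_zero_of_lt_one (show (0 : ℝ) ≤ 1 / 2 by norm_num) (by norm_num)
    exact (((this.const_sub 1).const_mul (1 / 2)).mul_const _).const_add _
  have := le_of_tendsto' hlim (fun k => key k u)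
  simpa using this

/-- the dual-averaging one-step recursion inequality.  If
`v i` minimizes `u ↦ ∑_{j<i} a_j⟨ζ_j, u⟩ + h(u)` for each `i ≤ r`, where
`h(w) = ‖w‖_q²/(2(q−1))`, then
`∑_{i<r} a_i⟨ζ_i, v_{i+1} − w*⟩ ≤ h(w*) − (1/2)∑_{i<r} ‖v_i − v_{i+1}‖_q²`. -/
theorem stmt1 (d : ℕ) (hd : 1 ≤ d) (p q : ℝ) (hp : 2 ≤ p)
    (hq1 : 1 < q) (hq2 : q ≤ 2) (hpq : 1 / p + 1 / q = 1)
    (h : (Fin d → ℝ) → ℝ) (hdef : ∀ w, h w = lpNorm q w ^ 2 / (2 * (q - 1)))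
    (r : ℕ) (ζ : ℕ → Fin d → ℝ) (a : ℕ → ℝ) (ha : ∀ i, i < r → 0 < a i)
    (v : ℕ → Fin d → ℝ)
    (hmin : ∀ i ≤ r, ∀ u : Fin d → ℝ,
      (∑ j ∈ Finset.range i, a j * (∑ l, ζ j l * v i l)) + h (v i)
        ≤ (∑ j ∈ Finset.range i, a j * (∑ l, ζ j l * u l)) + h u)
    (wstar : Fin d → ℝ) :
    ∑ i ∈ Finset.range r, a i * (∑ l, ζ i l * (v (i + 1) l - wstar l))
      ≤ h wstar - (1 / 2) * ∑ i ∈ Finset.range r, lpNorm q (v i - v (i + 1)) ^ 2 := by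
  have hstep : ∀ k ≤ r, (∑ i ∈ Finset.range k, a i * (∑ l, ζ i l * v (i + 1) l))
      + (1 / 2) * ∑ i ∈ Finset.range k, lpNorm q (v i - v (i + 1)) ^ 2
      ≤ (∑ j ∈ Finset.range k, a j * (∑ l, ζ j l * v k l)) + h (v k) := by
    intro k
    induction k with
    | zero =>
      intro _
      have hq : 0 < q - 1 := by linarith
      have : 0 ≤ h (v 0) := by rw [hdef]; positivity
      simpa using this
    | succ k ih =>
      intro hk
      have h1 := ih (by omega)
      have h2 := aux_growth q hq1 hq2
        (fun u => ∑ j ∈ Finset.range k, a j * (∑ l, ζ j l * u l))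
        (by
          intro x y
          rw [← Finset.sum_add_distrib, Finset.sum_div]
          refine Finset.sum_congr rfl fun j _ => ?_
          rw [← mul_add, ← Finset.sum_add_distrib, mul_div_assoc, Finset.sum_div]
          congr 1
          refine Finset.sum_congr rfl fun l _ => ?_
          simp only [Pi.smul_apply, Pi.add_apply, smul_eq_mul]
          ring)
        (v k) (by intro u; simpa only [hdef] using hmin k (by omega) u) (v (k + 1))
      simp only [← hdef] at h2
      rw [Finset.sum_range_succ, Finset.sum_range_succ, Finset.sum_range_succ]
      linarith
  have h1 := hstep r le_rfl
  have h2 := hmin r le_rfl wstar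
  have h3 : ∑ i ∈ Finset.range r, a i * (∑ l, ζ i l * (v (i + 1) l - wstar l))
      = (∑ i ∈ Finset.range r, a i * (∑ l, ζ i l * v (i + 1) l))
        - ∑ i ∈ Finset.range r, a i * (∑ l, ζ i l * wstar l) := by
    simp only [mul_sub, Finset.sum_sub_distrib]
  linarith
end
end

section
/- Let M, d ≥ 1, let U ∈ ℝ^{M×M} be a gossip matrix (symmetric, with nonnegative entries, doubly stochastic), let σ₂(U) denote the second-largest eigenvalue of U in absolute value, and set J_M := (1/M)𝟙𝟙ᵀ. Then for every A ∈ ℝ^{d×M}, every real p ≥ 1, and every integer t ≥ 0, ‖A(Uᵗ − J_M)‖_{p,2}² ≤ M · σ₂(U)^{2t} · ‖A‖_{p,2}². -/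
noncomputable section

open Real Matrix

/-- The squared `‖·‖_{p,2}` norm of a `d × M` matrix: the sum over columns of
the squared ℓ_p norms of the columns. -/
def colNormSq {d M : ℕ} (p : ℝ) (A : Matrix (Fin d) (Fin M) ℝ) : ℝ :=
  ∑ j, lpNorm p (fun i => A i j) ^ 2

/-- The second-largest (counting multiplicity) of the absolute values of the
eigenvalues of a real symmetric matrix. -/
def secondLargestAbsEigenvalue {M : ℕ} {U : Matrix (Fin M) (Fin M) ℝ}
    (hU : U.IsHermitian) : ℝ :=
  ((((Finset.univ : Finset (Fin M)).val.map fun i => |hU.eigenvalues i|).sort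
    (· ≤ ·)).reverse).getD 1 0

lemma lpNorm_nonneg_aux {d : ℕ} (p : ℝ) (x : Fin d → ℝ) : 0 ≤ lpNorm p x := by
  unfold lpNorm; positivity

lemma lpNorm_zero_aux {d : ℕ} (p : ℝ) (hp : 1 ≤ p) :
    lpNorm p (fun _ : Fin d => (0 : ℝ)) = 0 := by
  have h1 : p ≠ 0 := by linarith
  have h2 : p⁻¹ ≠ 0 := inv_ne_zero h1
  simp [lpNorm, Real.zero_rpow h1, Real.zero_rpow h2]

lemma lpNorm_smul_aux {d : ℕ} (p : ℝ) (hp : 1 ≤ p) (c : ℝ) (x : Fin d → ℝ) :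
    lpNorm p (fun i => x i * c) = lpNorm p x * |c| := by
  have h1 : p ≠ 0 := by linarith
  unfold lpNorm
  simp_rw [abs_mul]
  rw [Finset.sum_congr rfl fun i _ => Real.mul_rpow (abs_nonneg (x i)) (abs_nonneg c),
    ← Finset.sum_mul, Real.mul_rpow (by positivity) (by positivity), ← Real.rpow_mul (abs_nonneg c),
    mul_one_div_cancel h1, Real.rpow_one]

lemma lpNorm_sum_aux {d : ℕ} {ι : Type*} (p : ℝ) (hp : 1 ≤ p) (s : Finset ι)
    (f : ι → Fin d → ℝ) :
    lpNorm p (fun i => ∑ k ∈ s, f k i) ≤ ∑ k ∈ s, lpNorm p (f k) := by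
  classical
  induction s using Finset.induction_on with
  | empty => simp [lpNorm_zero_aux p hp]
  | insert a s ha ih =>
    simp_rw [Finset.sum_insert ha]
    have := Real.Lp_add_le Finset.univ (f a) (fun i => ∑ k ∈ s, f k i) hp
    unfold lpNorm at ih ⊢
    linarith

lemma colNormSq_mul_le {d M : ℕ} (p : ℝ) (hp : 1 ≤ p) (A : Matrix (Fin d) (Fin M) ℝ)
    (B : Matrix (Fin M) (Fin M) ℝ) :
    colNormSq p (A * B) ≤ (∑ j, ∑ k, B k j ^ 2) * colNormSq p A := by
  unfold colNormSq
  rw [Finset.sum_mul]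
  refine Finset.sum_le_sum fun j _ => ?_
  have h1 : lpNorm p (fun i => (A * B) i j) ≤ ∑ k, |B k j| * lpNorm p (fun i => A i k) := by
    simp_rw [Matrix.mul_apply]
    refine (lpNorm_sum_aux p hp Finset.univ (fun k i => A i k * B k j)).trans (le_of_eq ?_)
    refine Finset.sum_congr rfl fun k _ => ?_
    rw [lpNorm_smul_aux p hp, mul_comm]
  have h2 := Finset.sum_mul_sq_le_sq_mul_sq Finset.univ (fun k => |B k j|)
    (fun k => lpNorm p (fun i => A i k))
  simp_rw [sq_abs] at h2
  exact (pow_le_pow_left₀ (lpNorm_nonneg_aux _ _) h1 2).trans h2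

lemma abs_eigenvalue_le_one {M : ℕ} (U : Matrix (Fin M) (Fin M) ℝ) (hU : U.IsHermitian)
    (hnonneg : ∀ i j, 0 ≤ U i j) (hrow : ∀ i, ∑ j, U i j = 1) (i : Fin M) :
    |hU.eigenvalues i| ≤ 1 := by
  have hv := hU.mulVec_eigenvectorBasis i
  have hne : hU.eigenvectorBasis i ≠ 0 := hU.eigenvectorBasis.orthonormal.ne_zero i
  set v := hU.eigenvectorBasis i with hvdef
  obtain ⟨k, -, hk⟩ := Finset.exists_max_image Finset.univ (fun j => |v j|) ⟨i, Finset.mem_univ i⟩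
  have hpos : 0 < |v k| := by
    by_contra h
    apply hne
    ext j
    have h3 := hk j (Finset.mem_univ j)
    have h4 := abs_nonneg (v j)
    have : |v j| = 0 := by linarith
    simpa using this
  have h1 := congrFun hv k
  have h2 : ∑ j, U k j * v j = hU.eigenvalues i * v k := by
    simpa [Matrix.mulVec, dotProduct] using h1
  have h3 : |hU.eigenvalues i| * |v k| ≤ 1 * |v k| := by
    rw [← abs_mul, ← h2, ← hrow k, Finset.sum_mul]
    refine (Finset.abs_sum_le_sum_abs _ _).trans (Finset.sum_le_sum fun j _ => ?_)
    rw [abs_mul, abs_of_nonneg (hnonneg k j)]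
    exact mul_le_mul_of_nonneg_left (hk j (Finset.mem_univ j)) (hnonneg k j)
  exact le_of_mul_le_mul_right h3 hpos

lemma trace_pow_aux {M : ℕ} (U : Matrix (Fin M) (Fin M) ℝ) (hU : U.IsHermitian) (n : ℕ) :
    (U ^ n).trace = ∑ i, hU.eigenvalues i ^ n := by
  conv_lhs => rw [hU.spectral_theorem]
  rw [← map_pow, Matrix.diagonal_pow, Unitary.conjStarAlgAut_apply, Matrix.trace_mul_comm,
    ← mul_assoc, Unitary.coe_star_mul_self, one_mul, Matrix.trace_diagonal]
  simp

lemma list_aux (L : List ℝ) (hs : L.Pairwise (· ≥ ·)) (h0 : ∀ x ∈ L, 0 ≤ x)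
    (h1 : ∀ x ∈ L, x ≤ 1) (n : ℕ) :
    (L.map (· ^ n)).sum ≤ 1 + L.length * L.getD 1 0 ^ n ∧ 0 ≤ L.getD 1 0 := by
  match L with
  | [] => simp
  | [a] =>
    simp only [List.mem_singleton, forall_eq] at h0 h1
    have := pow_le_one₀ (n := n) h0 h1
    have h3 : (0 : ℝ) ≤ 0 ^ n := by positivity
    simp
    linarith
  | a :: b :: r =>
    have ha0 := h0 a (by simp)
    have ha1 := h1 a (by simp)
    have hb0 := h0 b (by simp)
    have := pow_le_one₀ (n := n) ha0 ha1
    have hr : ∀ y ∈ r.map (· ^ n), y ≤ b ^ n := by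
      intro y hy
      obtain ⟨x, hx, rfl⟩ := List.mem_map.1 hy
      have hx0 := h0 x (by simp [hx])
      have hxb : x ≤ b := (List.pairwise_cons.1 (List.pairwise_cons.1 hs).2).1 x hx
      exact pow_le_pow_left₀ hx0 hxb n
    have h5 := List.sum_le_card_nsmul _ _ hr
    have h6 : 0 ≤ b ^ n := by positivity
    simp at h5 ⊢
    exact ⟨by linarith, hb0⟩

lemma sum_eig_aux {M : ℕ} {U : Matrix (Fin M) (Fin M) ℝ} (hU : U.IsHermitian)
    (h : ∀ i, |hU.eigenvalues i| ≤ 1) (t : ℕ) :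
    ∑ i, hU.eigenvalues i ^ (2 * t) ≤ 1 + M * secondLargestAbsEigenvalue hU ^ (2 * t) := by
  set m := (Finset.univ : Finset (Fin M)).val.map fun i => |hU.eigenvalues i| with hm
  have hmem : ∀ x ∈ (m.sort (· ≤ ·)).reverse, ∃ i, |hU.eigenvalues i| = x := by
    intro x hx
    simpa [hm] using hx
  have key := (list_aux (m.sort (· ≤ ·)).reverse
    (by rw [List.pairwise_reverse]; exact m.pairwise_sort (· ≤ ·))
    (by intro x hx; obtain ⟨i, rfl⟩ := hmem x hx; positivity)
    (by intro x hx; obtain ⟨i, rfl⟩ := hmem x hx; exact h i) (2 * t)).1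
  have hlen : (m.sort (· ≤ ·)).reverse.length = M := by simp [hm]
  have hsum : ((m.sort (· ≤ ·)).reverse.map (· ^ (2 * t))).sum
      = ∑ i, hU.eigenvalues i ^ (2 * t) := by
    rw [List.map_reverse, List.sum_reverse, ← Multiset.sum_coe, ← Multiset.map_coe,
      Multiset.sort_eq, hm, Multiset.map_map]
    simp [Finset.sum, pow_mul]
  rw [hlen, hsum] at key
  exact key

lemma frob_aux {M : ℕ} (hM : 1 ≤ M) (U : Matrix (Fin M) (Fin M) ℝ) (hU : U.IsHermitian)
    (hrow : ∀ i, ∑ j, U i j = 1) (hcol : ∀ j, ∑ i, U i j = 1) (t : ℕ) :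
    ∑ j, ∑ k, (U ^ t - Matrix.of fun _ _ => (M : ℝ)⁻¹ : Matrix (Fin M) (Fin M) ℝ) k j ^ 2
      = ∑ i, hU.eigenvalues i ^ (2 * t) - 1 := by
  have hM' : (M : ℝ) ≠ 0 := by positivity
  have hc : ∀ (n : ℕ) (j), ∑ k, (U ^ n) k j = 1 := by
    intro n
    induction n with
    | zero => intro j; simp [Matrix.one_apply]
    | succ n ih =>
      intro j
      simp_rw [pow_succ, Matrix.mul_apply]
      rw [Finset.sum_comm]
      simp_rw [← Finset.sum_mul, ih, one_mul, hcol]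
  have hsymm : ∀ k j, (U ^ t) k j = (U ^ t) j k := fun k j => by
    have := (hU.pow t).apply j k
    simpa using this
  have htr : ∑ j, ∑ k, (U ^ t) k j ^ 2 = (U ^ (2 * t)).trace := by
    rw [two_mul, pow_add, Matrix.trace]
    refine Finset.sum_congr rfl fun j _ => ?_
    rw [Matrix.diag_apply, Matrix.mul_apply]
    refine Finset.sum_congr rfl fun k _ => ?_
    rw [hsymm j k, sq]
  rw [← trace_pow_aux, ← htr]
  simp only [Matrix.sub_apply, Matrix.of_apply, sub_sq, Finset.sum_add_distrib,
    Finset.sum_sub_distrib, ← Finset.sum_mul, ← Finset.mul_sum, hc]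
  simp
  field_simp
  ring

/-- mixing estimate for a gossip matrix.  For a symmetric,
entrywise-nonnegative, doubly stochastic `U` with second-largest absolute
eigenvalue `σ₂(U)`, and `J_M = (1/M)𝟙𝟙ᵀ`, every `A ∈ ℝ^{d×M}` satisfies
`‖A(Uᵗ − J_M)‖_{p,2}² ≤ M σ₂(U)^{2t} ‖A‖_{p,2}²`. -/
theorem stmt3 (M d : ℕ) (hM : 1 ≤ M) (hd : 1 ≤ d)
    (U : Matrix (Fin M) (Fin M) ℝ) (hU : U.IsHermitian)
    (hnonneg : ∀ i j, 0 ≤ U i j)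
    (hrow : ∀ i, ∑ j, U i j = 1) (hcol : ∀ j, ∑ i, U i j = 1)
    (A : Matrix (Fin d) (Fin M) ℝ) (p : ℝ) (hp : 1 ≤ p) (t : ℕ) :
    colNormSq p (A * (U ^ t - Matrix.of fun _ _ => (M : ℝ)⁻¹))
      ≤ M * secondLargestAbsEigenvalue hU ^ (2 * t) * colNormSq p A := by
  have h1 := colNormSq_mul_le p hp A (U ^ t - Matrix.of fun _ _ => (M : ℝ)⁻¹)
  refine h1.trans (mul_le_mul_of_nonneg_right ?_ ?_)
  · rw [frob_aux hM U hU hrow hcol t]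
    have := sum_eig_aux hU (abs_eigenvalue_le_one U hU hnonneg hrow) t
    linarith
  · exact Finset.sum_nonneg fun j _ => sq_nonneg _
end
end

section
/- Fix integers 1 ≤ s < d, I ≥ 1, and σ₁ > 0. Let x ∼ N(0, σ₁² I_d), and for w̃ ∈ ℝ^d define the population logistic loss f_{w̃}(w) := −E_x[ σ(⟨x, w̃⟩) log σ(⟨x, w⟩) + σ(−⟨x, w̃⟩) log σ(−⟨x, w⟩) ], where σ(z) = 1/(1 + e^{−z}). For i = 1, …, I let α^i ∈ ℝ^s, β^i ∈ ℝ^{d−s}, w̃^i := ((α^i)ᵀ, (β^i)ᵀ)ᵀ and w̃^{−i} := ((α^i)ᵀ, −(β^i)ᵀ)ᵀ, and set f := (1/(2I)) ∑_{i=1}^I (f_{w̃^i} + f_{w̃^{−i}}). Then there exists α ∈ span{α¹, …, α^I} such that w* = (αᵀ, 0_{d−s}ᵀ)ᵀ is the unique global minimizer of f. -/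
noncomputable section

open Real MeasureTheory ProbabilityTheory

/-- The softplus function. -/
def spl (z : ℝ) : ℝ := Real.log (1 + Real.exp z)

lemma spl_cont : Continuous spl := by
  unfold spl
  refine Continuous.log (by fun_prop) ?_
  intro x
  positivity

lemma spl_nonneg (z : ℝ) : 0 ≤ spl z := by
  unfold spl
  apply Real.log_nonneg
  have := Real.exp_pos z
  linarith

lemma spl_ge (z : ℝ) : z ≤ spl z := by
  unfold spl
  rw [Real.le_log_iff_exp_le (by positivity)]
  linarith

lemma spl_sub_le (a b : ℝ) : spl a - spl b ≤ |a - b| := by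
  have h : spl a ≤ |a - b| + spl b := by
    unfold spl
    rw [Real.log_le_iff_le_exp (by positivity), Real.exp_add, Real.exp_log (by positivity)]
    have h1 : (1 : ℝ) ≤ Real.exp |a - b| := Real.one_le_exp (abs_nonneg _)
    have h2 : Real.exp a ≤ Real.exp |a - b| * Real.exp b := by
      rw [← Real.exp_add]
      apply Real.exp_le_exp.2
      linarith [le_abs_self (a - b)]
    nlinarith
  linarith

lemma spl_lip (a b : ℝ) : |spl a - spl b| ≤ |a - b| := by
  rw [abs_le]
  have h1 := spl_sub_le a b
  have h2 := spl_sub_le b a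
  rw [abs_sub_comm] at h2
  constructor <;> linarith

lemma spl_mid_lt {a b : ℝ} (h : a ≠ b) : spl ((a + b) / 2) < (spl a + spl b) / 2 := by
  have ha : Real.exp a = Real.exp (a / 2) ^ 2 := by
    rw [← Real.exp_nat_mul]; congr 1; push_cast; ring
  have hb : Real.exp b = Real.exp (b / 2) ^ 2 := by
    rw [← Real.exp_nat_mul]; congr 1; push_cast; ring
  have hab : Real.exp ((a + b) / 2) = Real.exp (a / 2) * Real.exp (b / 2) := by
    rw [← Real.exp_add]; congr 1; ring
  have hne : Real.exp (a / 2) - Real.exp (b / 2) ≠ 0 := by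
    intro h'
    have := Real.exp_injective (sub_eq_zero.1 h')
    apply h; linarith
  have hsq : 0 < (Real.exp (a / 2) - Real.exp (b / 2)) ^ 2 := by positivity
  have key : 2 * spl ((a + b) / 2) < spl a + spl b := by
    unfold spl
    rw [← Real.log_mul (by positivity) (by positivity)]
    have : 2 * Real.log (1 + Real.exp ((a + b) / 2)) =
        Real.log ((1 + Real.exp ((a + b) / 2)) ^ 2) := by
      rw [Real.log_pow]; norm_num
    rw [this]
    apply Real.log_lt_log (by positivity)
    rw [ha, hb, hab]
    nlinarith
  linarith

lemma spl_mid_le (a b : ℝ) : spl ((a + b) / 2) ≤ (spl a + spl b) / 2 := by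
  by_cases h : a = b
  · subst h; simp
  · exact (spl_mid_lt h).le

lemma dotp_abs_le {n : ℕ} (x w : Fin n → ℝ) : |∑ i, x i * w i| ≤ (∑ i, |x i|) * ‖w‖ := by
  rw [Finset.sum_mul]
  refine (Finset.abs_sum_le_sum_abs _ _).trans (Finset.sum_le_sum fun i _ => ?_)
  rw [abs_mul]
  exact mul_le_mul_of_nonneg_left (norm_le_pi_norm w i) (abs_nonneg _)

lemma cont_of_lip {n : ℕ} (μ : Measure (Fin n → ℝ)) (ψ : (Fin n → ℝ) → (Fin n → ℝ) → ℝ)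
    (hint : ∀ w, Integrable (fun x => ψ x w) μ) (K : (Fin n → ℝ) → ℝ) (hK : Integrable K μ)
    (h : ∀ x w w', |ψ x w - ψ x w'| ≤ K x * ‖w - w'‖) :
    Continuous fun w => ∫ x, ψ x w ∂μ := by
  refine (LipschitzWith.of_dist_le' (K := ∫ x, K x ∂μ) fun w w' => ?_).continuous
  rw [Real.dist_eq, dist_eq_norm, ← integral_sub (hint w) (hint w'), ← integral_mul_const]
  refine (abs_integral_le_integral_abs).trans ?_
  exact integral_mono ((hint w).sub (hint w')).abs (hK.mul_const _) fun x => h x w w'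

/-- The reduced loss integrand. -/
def lossI {n : ℕ} (P : (Fin n → ℝ) → ℝ) (x w : Fin n → ℝ) : ℝ :=
  spl (∑ i, x i * w i) - P x * ∑ i, x i * w i

lemma K_int {n : ℕ} (μ : Measure (Fin n → ℝ))
    (hcoord : ∀ i, Integrable (fun x : Fin n → ℝ => x i) μ) :
    Integrable (fun x : Fin n → ℝ => ∑ i, |x i|) μ :=
  integrable_finsetSum _ fun i _ => (hcoord i).abs

lemma dotp_int {n : ℕ} (μ : Measure (Fin n → ℝ))
    (hcoord : ∀ i, Integrable (fun x : Fin n → ℝ => x i) μ) (w : Fin n → ℝ) :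
    Integrable (fun x : Fin n → ℝ => ∑ i, x i * w i) μ :=
  integrable_finsetSum _ fun i _ => (hcoord i).mul_const _

lemma lossI_cont {n : ℕ} (P : (Fin n → ℝ) → ℝ) (hPc : Continuous P) (w : Fin n → ℝ) :
    Continuous (fun x => lossI P x w) := by
  unfold lossI
  have := spl_cont
  fun_prop

lemma lossI_lip {n : ℕ} (P : (Fin n → ℝ) → ℝ) (hP0 : ∀ x, 0 < P x) (hP1 : ∀ x, P x < 1)
    (x w w' : Fin n → ℝ) :
    |lossI P x w - lossI P x w'| ≤ (2 * ∑ i, |x i|) * ‖w - w'‖ := by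
  have h1 := spl_lip (∑ i, x i * w i) (∑ i, x i * w' i)
  have h2 : ∑ i, x i * w i - ∑ i, x i * w' i = ∑ i, x i * (w - w') i := by
    rw [← Finset.sum_sub_distrib]
    exact Finset.sum_congr rfl fun i _ => by simp [mul_sub]
  have h3 := dotp_abs_le x (w - w')
  rw [← h2] at h3
  have h4 : |P x * (∑ i, x i * w i - ∑ i, x i * w' i)| ≤
      |∑ i, x i * w i - ∑ i, x i * w' i| := by
    rw [abs_mul, abs_of_pos (hP0 x)]
    exact mul_le_of_le_one_left (abs_nonneg _) (hP1 x).le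
  have h5 : lossI P x w - lossI P x w' = (spl (∑ i, x i * w i) - spl (∑ i, x i * w' i)) -
      P x * (∑ i, x i * w i - ∑ i, x i * w' i) := by
    unfold lossI; ring
  rw [h5]
  refine (abs_sub _ _).trans ?_
  linarith

lemma lossI_int {n : ℕ} (μ : Measure (Fin n → ℝ)) [IsProbabilityMeasure μ]
    (hcoord : ∀ i, Integrable (fun x : Fin n → ℝ => x i) μ)
    (P : (Fin n → ℝ) → ℝ) (hPc : Continuous P) (hP0 : ∀ x, 0 < P x) (hP1 : ∀ x, P x < 1)
    (w : Fin n → ℝ) : Integrable (fun x => lossI P x w) μ := by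
  have hK := (((K_int μ hcoord).const_mul 2).mul_const ‖w‖).add (integrable_const (μ := μ) (spl 0))
  refine hK.mono' (lossI_cont P hPc w).aestronglyMeasurable (Filter.Eventually.of_forall fun x => ?_)
  have h := lossI_lip P hP0 hP1 x w 0
  have h0 : lossI P x 0 = spl 0 := by simp [lossI]
  rw [h0, sub_zero] at h
  rw [Real.norm_eq_abs]
  have h1 := abs_sub_abs_le_abs_sub (lossI P x w) (spl 0)
  rw [abs_of_nonneg (spl_nonneg 0)] at h1
  simp only [Pi.add_apply]
  linarith

lemma lossI_ge {n : ℕ} (P : (Fin n → ℝ) → ℝ) (hP0 : ∀ x, 0 < P x) (hP1 : ∀ x, P x < 1)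
    (x w : Fin n → ℝ) : P x * (1 - P x) * |∑ i, x i * w i| ≤ lossI P x w := by
  unfold lossI
  set z := ∑ i, x i * w i
  have a := hP0 x
  have b := hP1 x
  have c := spl_nonneg z
  have e := spl_ge z
  rcases le_total 0 z with h | h
  · rw [abs_of_nonneg h]
    have : P x * (1 - P x) ≤ 1 - P x := by nlinarith
    nlinarith
  · rw [abs_of_nonpos h]
    have : P x * (1 - P x) ≤ P x := by nlinarith
    nlinarith

lemma exists_min {n : ℕ} (μ : Measure (Fin n → ℝ)) [IsProbabilityMeasure μ] [μ.IsOpenPosMeasure]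
    (hcoord : ∀ i, Integrable (fun x : Fin n → ℝ => x i) μ)
    (P : (Fin n → ℝ) → ℝ) (hPc : Continuous P) (hP0 : ∀ x, 0 < P x) (hP1 : ∀ x, P x < 1) :
    ∃ w₀, ∀ w, ∫ x, lossI P x w₀ ∂μ ≤ ∫ x, lossI P x w ∂μ := by
  have hint := lossI_int μ hcoord P hPc hP0 hP1
  have hcont : Continuous fun w => ∫ x, lossI P x w ∂μ :=
    cont_of_lip μ _ hint _ ((K_int μ hcoord).const_mul 2) (lossI_lip P hP0 hP1)
  set g : (Fin n → ℝ) → (Fin n → ℝ) → ℝ := fun x w => P x * (1 - P x) * |∑ i, x i * w i| with hg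
  have hm : ∀ x, 0 < P x * (1 - P x) := fun x => mul_pos (hP0 x) (sub_pos.2 (hP1 x))
  have hm1 : ∀ x, P x * (1 - P x) ≤ 1 := fun x => by nlinarith [hP0 x, hP1 x]
  have hgc : ∀ w, Continuous fun x => g x w := fun w => by
    simp only [hg]; fun_prop
  have hgint : ∀ w, Integrable (fun x => g x w) μ := fun w => by
    refine (dotp_int μ hcoord w).abs.mono' (hgc w).aestronglyMeasurable
      (Filter.Eventually.of_forall fun x => ?_)
    rw [Real.norm_eq_abs, abs_mul, abs_of_pos (hm x), abs_abs]
    exact mul_le_of_le_one_left (abs_nonneg _) (hm1 x)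
  have hgcont : Continuous fun w => ∫ x, g x w ∂μ := by
    refine cont_of_lip μ _ hgint _ (K_int μ hcoord) fun x w w' => ?_
    have h2 : ∑ i, x i * w i - ∑ i, x i * w' i = ∑ i, x i * (w - w') i := by
      rw [← Finset.sum_sub_distrib]
      exact Finset.sum_congr rfl fun i _ => by simp [mul_sub]
    have h3 := dotp_abs_le x (w - w')
    rw [← h2] at h3
    simp only [hg]
    rw [← mul_sub, abs_mul, abs_of_pos (hm x)]
    exact (mul_le_of_le_one_left (abs_nonneg _) (hm1 x)).trans
      ((abs_abs_sub_abs_le_abs_sub _ _).trans h3)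
  have hgpos : ∀ w, w ≠ 0 → 0 < ∫ x, g x w ∂μ := fun w hw => by
    refine integral_pos_of_integrable_nonneg_nonzero (x := w) (hgc w) (hgint w)
      (fun x => mul_nonneg (hm x).le (abs_nonneg _)) ?_
    have : ∑ i, w i * w i ≠ 0 := by
      intro h
      apply hw
      ext i
      have := (Finset.sum_eq_zero_iff_of_nonneg (fun i _ => mul_self_nonneg (w i))).1 h i
        (Finset.mem_univ i)
      simpa using this
    exact mul_ne_zero (hm w).ne' (abs_ne_zero.2 this)
  obtain ⟨c, hc, hcle⟩ := (isCompact_sphere (0 : Fin n → ℝ) 1).exists_forall_le'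
    hgcont.continuousOn (a := 0) (fun w hw => hgpos w (by
      rintro rfl
      simp at hw))
  have hcoer : ∀ w, c * ‖w‖ ≤ ∫ x, lossI P x w ∂μ := fun w => by
    have h1 : c * ‖w‖ ≤ ∫ x, g x w ∂μ := by
      by_cases hw : w = 0
      · subst hw; simp [hg]
      have hn : 0 < ‖w‖ := norm_pos_iff.2 hw
      have h := hcle (‖w‖⁻¹ • w) (by simp [norm_smul, hn.ne'])
      have h2 : ∫ x, g x (‖w‖⁻¹ • w) ∂μ = (∫ x, g x w ∂μ) * ‖w‖⁻¹ := by
        rw [← integral_mul_const]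
        congr 1
        ext x
        simp only [hg]
        have : ∑ i, x i * (‖w‖⁻¹ • w) i = (∑ i, x i * w i) * ‖w‖⁻¹ := by
          rw [Finset.sum_mul]
          exact Finset.sum_congr rfl fun i _ => by simp; ring
        rw [this, abs_mul, abs_of_pos (inv_pos.2 hn), ← mul_assoc]
      rw [h2, ← div_eq_mul_inv, le_div_iff₀ hn] at h
      exact h
    exact h1.trans (integral_mono (hgint w) (hint w) fun x => lossI_ge P hP0 hP1 x w)
  refine hcont.exists_forall_le (Filter.tendsto_atTop_mono hcoer ?_)
  exact (tendsto_norm_cocompact_atTop).const_mul_atTop hc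

lemma min_unique {n : ℕ} (μ : Measure (Fin n → ℝ)) [IsProbabilityMeasure μ] [μ.IsOpenPosMeasure]
    (hcoord : ∀ i, Integrable (fun x : Fin n → ℝ => x i) μ)
    (P : (Fin n → ℝ) → ℝ) (hPc : Continuous P) (hP0 : ∀ x, 0 < P x) (hP1 : ∀ x, P x < 1)
    (w₀ : Fin n → ℝ) (hmin : ∀ w, ∫ x, lossI P x w₀ ∂μ ≤ ∫ x, lossI P x w ∂μ)
    (w₁ : Fin n → ℝ) (hne : w₁ ≠ w₀) : ∫ x, lossI P x w₀ ∂μ < ∫ x, lossI P x w₁ ∂μ := by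
  have hint := lossI_int μ hcoord P hPc hP0 hP1
  have hc := lossI_cont P hPc
  set wm : Fin n → ℝ := fun i => (w₁ i + w₀ i) / 2 with hwm
  have hdot : ∀ x : Fin n → ℝ, ∑ i, x i * wm i = (∑ i, x i * w₁ i + ∑ i, x i * w₀ i) / 2 := by
    intro x
    rw [← Finset.sum_add_distrib, Finset.sum_div]
    exact Finset.sum_congr rfl fun i _ => by simp only [hwm]; ring
  have hpos : 0 < ∫ x, (lossI P x w₁ + lossI P x w₀ - 2 * lossI P x wm) ∂μ := by
    refine integral_pos_of_integrable_nonneg_nonzero (x := w₁ - w₀)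
      (((hc w₁).add (hc w₀)).sub ((hc wm).const_mul 2))
      (((hint w₁).add (hint w₀)).sub ((hint wm).const_mul 2)) (fun x => ?_) ?_
    · have := spl_mid_le (∑ i, x i * w₁ i) (∑ i, x i * w₀ i)
      simp only [Pi.zero_apply, lossI, hdot x]
      linarith
    · have hd : ∑ i, (w₁ - w₀) i * w₁ i ≠ ∑ i, (w₁ - w₀) i * w₀ i := by
        intro h
        apply hne
        rw [← sub_eq_zero, ← Finset.sum_sub_distrib] at h
        have h' : ∑ i, (w₁ i - w₀ i) * (w₁ i - w₀ i) = 0 := by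
          rw [← h]
          exact Finset.sum_congr rfl fun i _ => by simp; ring
        ext i
        have := (Finset.sum_eq_zero_iff_of_nonneg
          (fun i _ => mul_self_nonneg (w₁ i - w₀ i))).1 h' i (Finset.mem_univ i)
        rw [mul_self_eq_zero] at this
        linarith
      have := spl_mid_lt hd
      simp only [lossI, hdot]
      apply ne_of_gt
      linarith
  rw [integral_sub (f := fun x => lossI P x w₁ + lossI P x w₀) ((hint w₁).add (hint w₀)) ((hint wm).const_mul 2),
    integral_add (hint w₁) (hint w₀), integral_const_mul] at hpos
  have := hmin wm
  linarith

/-- Rotation invariance of the isotropic product Gaussian. -/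
lemma gauss_rot {n : ℕ} (v : NNReal)
    (R : EuclideanSpace ℝ (Fin n) ≃ₗᵢ[ℝ] EuclideanSpace ℝ (Fin n)) :
    ((Measure.pi (fun _ : Fin n => gaussianReal 0 v)).map (WithLp.toLp 2)).map R =
      (Measure.pi (fun _ : Fin n => gaussianReal 0 v)).map (WithLp.toLp 2) := by
  have hcf : ∀ t : EuclideanSpace ℝ (Fin n),
      charFun ((Measure.pi (fun _ : Fin n => gaussianReal 0 v)).map (WithLp.toLp 2)) t =
        Complex.exp (-(v * ‖t‖ ^ 2 / 2 : ℝ)) := by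
    intro t
    simp_rw [charFun_pi, charFun_gaussianReal, ← Complex.exp_sum,
      EuclideanSpace.real_norm_sq_eq]
    congr 1
    push_cast
    simp [Finset.sum_div, Finset.mul_sum]
  have : IsProbabilityMeasure
      ((Measure.pi (fun _ : Fin n => gaussianReal 0 v)).map (WithLp.toLp 2)) :=
    Measure.isProbabilityMeasure_map (by fun_prop)
  have : IsProbabilityMeasure
      (((Measure.pi (fun _ : Fin n => gaussianReal 0 v)).map (WithLp.toLp 2)).map R) :=
    Measure.isProbabilityMeasure_map (by fun_prop)
  apply Measure.ext_of_charFun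
  ext t
  have h1 : charFun (((Measure.pi (fun _ : Fin n => gaussianReal 0 v)).map (WithLp.toLp 2)).map R) t
      = charFun ((Measure.pi (fun _ : Fin n => gaussianReal 0 v)).map (WithLp.toLp 2)) (R.symm t) := by
    simp only [charFun_apply]
    rw [integral_map (by fun_prop) (by fun_prop)]
    congr 1
    ext x
    rw [← R.inner_map_map x (R.symm t), R.apply_symm_apply]
  rw [h1, hcf, hcf, R.symm.norm_map]

lemma loss_inv {n : ℕ} (v : NNReal)
    (R : EuclideanSpace ℝ (Fin n) ≃ₗᵢ[ℝ] EuclideanSpace ℝ (Fin n))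
    (P : (Fin n → ℝ) → ℝ) (hPc : Continuous P)
    (hPR : ∀ x, P (R (WithLp.toLp 2 x)).ofLp = P x) (w : Fin n → ℝ) :
    ∫ x, lossI P x (R (WithLp.toLp 2 w)).ofLp ∂(Measure.pi (fun _ : Fin n => gaussianReal 0 v)) =
    ∫ x, lossI P x w ∂(Measure.pi (fun _ : Fin n => gaussianReal 0 v)) := by
  set μ := Measure.pi (fun _ : Fin n => gaussianReal 0 v)
  have hcE : ∀ w : Fin n → ℝ, Continuous fun y : EuclideanSpace ℝ (Fin n) => lossI P y.ofLp w :=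
    fun w => (lossI_cont P hPc w).comp (PiLp.continuous_ofLp 2 _)
  have hE : ∀ w : Fin n → ℝ, ∫ x, lossI P x w ∂μ =
      ∫ y, lossI P y.ofLp w ∂(μ.map (WithLp.toLp 2)) := fun w => by
    rw [integral_map (by fun_prop) (hcE w).aestronglyMeasurable]
  rw [hE, hE, ← gauss_rot v R, integral_map (by fun_prop) (hcE _).aestronglyMeasurable, gauss_rot v R]
  congr 1
  ext y
  have h1 : ∑ i, (R y).ofLp i * (R (WithLp.toLp 2 w)).ofLp i = ∑ i, y.ofLp i * w i := by
    have := R.inner_map_map y (WithLp.toLp 2 w)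
    simp only [PiLp.inner_apply, RCLike.inner_apply, conj_trivial] at this
    simpa [mul_comm] using this
  have h2 := hPR y.ofLp
  simp only [WithLp.toLp_ofLp] at h2
  unfold lossI
  rw [h1, h2]

/-- decentralized sparse logistic regression with `2I` paired
clients.  Writing `d = s + t` (so `1 ≤ s < d`), with Gaussian covariates
`x ∼ N(0, σ₁² I_d)` and client parameters `w̃^i = (α^i, β^i)`,
`w̃^{−i} = (α^i, −β^i)`, there is `α ∈ span{α¹, …, α^I}` such that
`w* = (α, 0)` is the unique global minimizer of the averaged population
logistic loss. -/
theorem stmt13 (s t I : ℕ) (hs : 1 ≤ s) (ht : 1 ≤ t) (hI : 1 ≤ I)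
    (σ1 : ℝ) (hσ1 : 0 < σ1)
    (μ : Measure (Fin (s + t) → ℝ))
    (hμ : μ = Measure.pi fun _ => gaussianReal 0 (Real.toNNReal (σ1 ^ 2)))
    (sig : ℝ → ℝ) (hsig : ∀ z, sig z = (1 + Real.exp (-z))⁻¹)
    (floss : (Fin (s + t) → ℝ) → (Fin (s + t) → ℝ) → ℝ)
    (hfloss : ∀ wtil w, floss wtil w =
      -∫ x, (sig (∑ i, x i * wtil i) * Real.log (sig (∑ i, x i * w i)) +
        sig (-∑ i, x i * wtil i) * Real.log (sig (-∑ i, x i * w i))) ∂μ)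
    (A : Fin I → Fin s → ℝ) (B : Fin I → Fin t → ℝ)
    (f : (Fin (s + t) → ℝ) → ℝ)
    (hf : ∀ w, f w = (1 / (2 * (I : ℝ))) *
      ∑ i, (floss (Fin.append (A i) (B i)) w +
        floss (Fin.append (A i) (-(B i))) w)) :
    ∃ α : Fin s → ℝ, α ∈ Submodule.span ℝ (Set.range A) ∧
      ∀ w : Fin (s + t) → ℝ, w ≠ Fin.append α 0 →
        f (Fin.append α 0) < f w := by
  have hv : Real.toNNReal (σ1 ^ 2) ≠ 0 := by
    have : 0 < σ1 ^ 2 := by positivity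
    exact (Real.toNNReal_pos.2 this).ne'
  set v := Real.toNNReal (σ1 ^ 2) with hvdef
  have hop : (gaussianReal 0 v).IsOpenPosMeasure :=
    (gaussianReal_absolutelyContinuous' 0 hv).isOpenPosMeasure
  have hμp : IsProbabilityMeasure μ := by rw [hμ]; infer_instance
  have hμo : μ.IsOpenPosMeasure := by rw [hμ]; infer_instance
  have hcoord : ∀ i, Integrable (fun x : Fin (s + t) → ℝ => x i) μ := fun i => by
    rw [hμ]
    exact integrable_comp_eval (μ := fun _ : Fin (s + t) => gaussianReal 0 v) (i := i)
      (f := fun y : ℝ => y) ((memLp_id_gaussianReal 1).integrable le_rfl)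
  -- the sigmoid
  have hs0 : ∀ z, 0 < sig z := fun z => by rw [hsig]; positivity
  have hs1 : ∀ z, sig z < 1 := fun z => by
    rw [hsig]
    apply inv_lt_one_of_one_lt₀
    linarith [Real.exp_pos (-z)]
  have hsc : Continuous sig := by
    rw [show sig = fun z => (1 + Real.exp (-z))⁻¹ from funext hsig]
    refine Continuous.inv₀ (by fun_prop) fun z => ?_
    positivity
  have hpt : ∀ a b, sig a * Real.log (sig b) + sig (-a) * Real.log (sig (-b)) =
      -(spl b - sig a * b) := by
    intro a b
    have h1 : Real.log (sig (-b)) = - spl b := by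
      rw [hsig, Real.log_inv, neg_neg]; rfl
    have h2 : Real.log (sig b) = b - spl b := by
      have : 1 + Real.exp (-b) = Real.exp (-b) * (1 + Real.exp b) := by
        rw [mul_add, ← Real.exp_add]; simp [add_comm]
      rw [hsig, Real.log_inv, this, Real.log_mul (by positivity) (by positivity), Real.log_exp]
      unfold spl; ring
    have h3 : sig (-a) = 1 - sig a := by
      rw [hsig, hsig, neg_neg]
      have : Real.exp (-a) * Real.exp a = 1 := by rw [← Real.exp_add]; simp
      field_simp
      nlinarith
    rw [h1, h2, h3]; ring
  have hfl : ∀ wt w, floss wt w = ∫ x, lossI (fun x => sig (∑ i, x i * wt i)) x w ∂μ := by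
    intro wt w
    rw [hfloss, ← integral_neg]
    congr 1
    ext x
    rw [hpt]
    simp [lossI]
  have hflint : ∀ wt w : Fin (s + t) → ℝ, Integrable (fun x => lossI (fun x => sig (∑ i, x i * wt i)) x w) μ :=
    fun wt w => lossI_int μ hcoord _ (by fun_prop) (fun _ => hs0 _) (fun _ => hs1 _) w
  have hIpos : (0 : ℝ) < I := by exact_mod_cast hI
  set P : (Fin (s + t) → ℝ) → ℝ := fun x => (1 / (2 * (I : ℝ))) *
    ∑ j, (sig (∑ i, x i * Fin.append (A j) (B j) i) +
      sig (∑ i, x i * Fin.append (A j) (-(B j)) i)) with hP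
  have hPc : Continuous P := by
    simp only [hP]; fun_prop
  have hne : (Finset.univ : Finset (Fin I)).Nonempty := ⟨⟨0, hI⟩, Finset.mem_univ _⟩
  have hP0 : ∀ x, 0 < P x := fun x =>
    mul_pos (by positivity) (Finset.sum_pos (fun j _ => add_pos (hs0 _) (hs0 _)) hne)
  have hP1 : ∀ x, P x < 1 := fun x => by
    have h : ∑ j, (sig (∑ i, x i * Fin.append (A j) (B j) i) +
      sig (∑ i, x i * Fin.append (A j) (-(B j)) i)) < ∑ j : Fin I, (2 : ℝ) := by
      refine Finset.sum_lt_sum_of_nonempty hne fun j _ => ?_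
      linarith [hs1 (∑ i, x i * Fin.append (A j) (B j) i),
        hs1 (∑ i, x i * Fin.append (A j) (-(B j)) i)]
    simp only [Finset.sum_const, Finset.card_univ, Fintype.card_fin, nsmul_eq_mul] at h
    simp only [hP]
    rw [one_div_mul_eq_div, div_lt_one (by positivity)]
    linarith
  have hfF : ∀ w, f w = ∫ x, lossI P x w ∂μ := by
    intro w
    rw [hf]
    simp_rw [hfl]
    have e : ∀ j, (∫ x, lossI (fun x => sig (∑ i, x i * Fin.append (A j) (B j) i)) x w ∂μ) +
        (∫ x, lossI (fun x => sig (∑ i, x i * Fin.append (A j) (-(B j)) i)) x w ∂μ) =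
        ∫ x, (lossI (fun x => sig (∑ i, x i * Fin.append (A j) (B j) i)) x w +
          lossI (fun x => sig (∑ i, x i * Fin.append (A j) (-(B j)) i)) x w) ∂μ :=
      fun j => (integral_add (hflint _ w) (hflint _ w)).symm
    simp_rw [e]
    rw [← integral_finsetSum (f := fun j x =>
      lossI (fun x => sig (∑ i, x i * Fin.append (A j) (B j) i)) x w +
      lossI (fun x => sig (∑ i, x i * Fin.append (A j) (-(B j)) i)) x w) _
      (fun j _ => (hflint _ w).add (hflint _ w)), ← integral_const_mul]
    congr 1
    ext x
    simp only [lossI, hP]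
    have : ∀ z y : ℝ, ∀ a b : Fin I → ℝ, ∑ j, ((y - a j * z) + (y - b j * z)) =
        2 * I * y - (∑ j, (a j + b j)) * z := by
      intro z y a b
      rw [Finset.sum_mul, show 2 * (I : ℝ) * y = ∑ j : Fin I, 2 * y by simp; ring,
        ← Finset.sum_sub_distrib]
      exact Finset.sum_congr rfl fun j _ => by ring
    rw [this]
    field_simp
  -- the symmetry
  let L : (Fin s → ℝ) →ₗ[ℝ] EuclideanSpace ℝ (Fin (s + t)) :=
    { toFun := fun a => WithLp.toLp 2 (Fin.append a 0)
      map_add' := fun a b => by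
        ext i
        refine Fin.addCases (fun i => ?_) (fun i => ?_) i <;> simp
      map_smul' := fun c a => by
        ext i
        refine Fin.addCases (fun i => ?_) (fun i => ?_) i <;> simp }
  have hL : ∀ a, L a = WithLp.toLp 2 (Fin.append a 0) := fun a => rfl
  let V : Submodule ℝ (EuclideanSpace ℝ (Fin (s + t))) :=
    (Submodule.span ℝ (Set.range A)).map L
  have hVA : ∀ j, L (A j) ∈ V := fun j =>
    Submodule.mem_map_of_mem (Submodule.subset_span ⟨j, rfl⟩)
  have hVB : ∀ b : Fin t → ℝ, WithLp.toLp 2 (Fin.append (0 : Fin s → ℝ) b) ∈ Vᗮ := by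
    intro b
    rw [Submodule.mem_orthogonal]
    rintro u ⟨a, -, rfl⟩
    rw [hL]
    simp [PiLp.inner_apply, Fin.sum_univ_add]
  have hsplit : ∀ (a : Fin s → ℝ) (b : Fin t → ℝ), (WithLp.toLp 2 (Fin.append a b) :
      EuclideanSpace ℝ (Fin (s + t))) = L a + WithLp.toLp 2 (Fin.append (0 : Fin s → ℝ) b) := by
    intro a b
    rw [hL]
    ext i
    refine Fin.addCases (fun i => ?_) (fun i => ?_) i <;> simp
  have hR : ∀ j b, V.reflection (WithLp.toLp 2 (Fin.append (A j) b)) =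
      WithLp.toLp 2 (Fin.append (A j) (-b)) := by
    intro j b
    rw [hsplit, map_add, Submodule.reflection_mem_subspace_eq_self (hVA j),
      Submodule.reflection_mem_subspace_orthogonalComplement_eq_neg (hVB b), hsplit (A j) (-b)]
    congr 1
    ext i
    refine Fin.addCases (fun i => ?_) (fun i => ?_) i <;> simp
  have hdotR : ∀ x w : Fin (s + t) → ℝ, ∑ i, (V.reflection (WithLp.toLp 2 x)).ofLp i * w i =
      ∑ i, x i * (V.reflection (WithLp.toLp 2 w)).ofLp i := by
    intro x w
    have := V.reflection.inner_map_map (WithLp.toLp 2 x) (V.reflection (WithLp.toLp 2 w))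
    rw [Submodule.reflection_reflection] at this
    simp only [PiLp.inner_apply, RCLike.inner_apply, conj_trivial] at this
    simpa [mul_comm] using this
  have hPR : ∀ x, P (V.reflection (WithLp.toLp 2 x)).ofLp = P x := by
    intro x
    simp only [hP]
    congr 1
    refine Finset.sum_congr rfl fun j _ => ?_
    rw [hdotR, hdotR, hR, hR, neg_neg, add_comm]
  obtain ⟨w₀, hw₀⟩ := exists_min μ hcoord P hPc hP0 hP1
  have huniq := min_unique μ hcoord P hPc hP0 hP1 w₀ hw₀
  have hfix : (V.reflection (WithLp.toLp 2 w₀)).ofLp = w₀ := by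
    by_contra hcon
    have h1 := huniq _ hcon
    have h2 := loss_inv v V.reflection P hPc hPR w₀
    rw [← hμ] at h2
    linarith
  have hmem : WithLp.toLp 2 w₀ ∈ V := by
    rw [← Submodule.reflection_eq_self_iff, ← WithLp.toLp_ofLp 2 (V.reflection _), hfix]
  obtain ⟨α, hα, hαw⟩ := hmem
  have hw : Fin.append α 0 = w₀ := by
    have := congrArg WithLp.ofLp hαw
    simpa [hL] using this
  refine ⟨α, hα, fun w hne' => ?_⟩
  rw [hw] at hne' ⊢
  rw [hfF, hfF]
  exact huniq w hne'
end
end
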